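/- Let a ≥ b > 0 and b ≤ r ≤ a. Then the area of the set {x ∈ ℝ² : (sphere(x,r) ∩ C(a,b)) has cardinality 2} equals 2πr² + 2πab. -/

import Mathlib

open Real MeasureTheory Set Metric

noncomputable section

/-- The Euclidean plane. -/
abbrev E2 := EuclideanSpace ℝ (Fin 2)

/-- Closed elliptical region with semi-axes `a`, `b`. -/
def Kset (a b : ℝ) : Set E2 := {x | (x 0)^2 / a^2 + (x 1)^2 / b^2 ≤ 1}

/-- The ellipse with semi-axes `a`, `b`. -/
def Cset (a b : ℝ) : Set E2 := {x | (x 0)^2 / a^2 + (x 1)^2 / b^2 = 1}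

/-- Incomplete elliptic integral of the second kind `E(φ, ε)`. -/
def Einc (ε φ : ℝ) : ℝ := ∫ θ in (0:ℝ)..φ, Real.sqrt (1 - ε^2 * Real.sin θ^2)

/-- Complete elliptic integral of the second kind `E(ε)`. -/
def Ecomp (ε : ℝ) : ℝ := Einc ε (π/2)

/-- Eccentricity of the ellipse with semi-axes `a ≥ b`. -/
def ecc (a b : ℝ) : ℝ := Real.sqrt (a^2 - b^2) / a

open scoped ENNReal Polynomial

/-- The **area formula**. -/
theorem lintegral_encard_fiber {E : Type*} [NormedAddCommGroup E] [NormedSpace ℝ E]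
    [FiniteDimensional ℝ E] [MeasurableSpace E] [BorelSpace E] (μ : Measure E) [μ.IsAddHaarMeasure]
    {f : E → E} {f' : E → E →L[ℝ] E} {s : Set E} (hs : MeasurableSet s)
    (hf : ∀ x, HasFDerivAt f (f' x) x) (hdet : Measurable fun x => (f' x).det) :
    AEMeasurable (fun y => ((s ∩ f ⁻¹' {y}).encard : ℝ≥0∞)) μ ∧
      ∫⁻ y, ((s ∩ f ⁻¹' {y}).encard : ℝ≥0∞) ∂μ = ∫⁻ x in s, ENNReal.ofReal |(f' x).det| ∂μ := by
  set Z : Set E := {x | (f' x).det = 0}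
  have hZ : MeasurableSet Z := hdet (measurableSet_singleton 0)
  set u : Set E := s \ Z
  have hu : MeasurableSet u := hs.diff hZ
  have hloc : ∀ A : E →L[ℝ] E, ∃ c : NNReal, c ≠ 0 ∧ ∀ t : Set E, A.det ≠ 0 →
      ApproximatesLinearOn f A t c → InjOn f t := by
    intro A
    by_cases hA : A.det = 0
    · exact ⟨1, one_ne_zero, fun t h => absurd hA h⟩
    let B := A.toContinuousLinearEquivOfDetNeZero hA
    rcases subsingleton_or_nontrivial E with hE | hE
    · exact ⟨1, one_ne_zero, fun t _ _ x _ y _ _ => Subsingleton.elim x y⟩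
    have hpos : 0 < ‖(B.symm : E →L[ℝ] E)‖₊⁻¹ := by
      have := B.nnnorm_symm_pos
      positivity
    obtain ⟨c, hc0, hc⟩ := exists_between hpos
    refine ⟨c, hc0.ne', fun t _ h => ?_⟩
    exact ApproximatesLinearOn.injOn (f' := B) h (Or.inr hc)
  choose c hc0 hc using hloc
  obtain ⟨t, A, tdisj, tmeas, tcov, tapp, tA⟩ :=
    exists_partition_approximatesLinearOn_of_hasFDerivWithinAt f u f'
      (fun x _ => (hf x).hasFDerivWithinAt) c hc0
  have hinj : ∀ n, InjOn f (u ∩ t n) := by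
    intro n
    rcases u.eq_empty_or_nonempty with h | h
    · simp [h]
    obtain ⟨y, hy, hAy⟩ := tA h n
    exact hc (A n) _ (by rw [hAy]; exact hy.2) (tapp n)
  have hm : ∀ n, MeasurableSet (u ∩ t n) := fun n => hu.inter (tmeas n)
  have himg : ∀ n, MeasurableSet (f '' (u ∩ t n)) := fun n =>
    measurable_image_of_fderivWithin (hm n) (fun x _ => (hf x).hasFDerivWithinAt) (hinj n)
  have hdisj : Pairwise (Function.onFun Disjoint fun n => u ∩ t n) := fun i j hij =>
    (tdisj hij).mono inter_subset_right inter_subset_right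
  have huU : u = ⋃ n, u ∩ t n := by
    rw [← inter_iUnion]; exact (inter_eq_left.2 tcov).symm
  have hfcont : Continuous f := continuous_iff_continuousAt.2 fun x => (hf x).continuousAt
  have hcount : ∀ y, ((u ∩ f ⁻¹' {y}).encard : ℝ≥0∞) =
      ∑' n, (f '' (u ∩ t n)).indicator 1 y := by
    intro y
    have hfy : MeasurableSet (f ⁻¹' {y}) := hfcont.measurable (measurableSet_singleton y)
    rw [← Measure.count_apply (hu.inter hfy)]
    conv_lhs => rw [huU, iUnion_inter]
    rw [measure_iUnion (fun i j hij => (hdisj hij).mono inter_subset_left inter_subset_left)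
      (fun n => (hm n).inter hfy)]
    congr 1 with n
    rw [Measure.count_apply ((hm n).inter hfy)]
    by_cases hy : y ∈ f '' (u ∩ t n)
    · obtain ⟨x, hx, rfl⟩ := hy
      have : u ∩ t n ∩ f ⁻¹' {f x} = {x} := by
        ext z
        constructor
        · rintro ⟨hz, hzx⟩
          exact hinj n hz hx hzx
        · rintro rfl
          exact ⟨hx, rfl⟩
      rw [this, indicator_of_mem (mem_image_of_mem f hx)]
      simp
    · have : u ∩ t n ∩ f ⁻¹' {y} = ∅ := by
        ext z
        simp only [mem_empty_iff_false, iff_false]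
        rintro ⟨hz, rfl⟩
        exact hy ⟨z, hz, rfl⟩
      rw [this, indicator_of_notMem hy]
      simp
  have hnull : μ (f '' (s ∩ Z)) = 0 :=
    addHaar_image_eq_zero_of_det_fderivWithin_eq_zero μ
      (fun x _ => (hf x).hasFDerivWithinAt) (fun x hx => hx.2)
  have hae : (fun y => ((s ∩ f ⁻¹' {y}).encard : ℝ≥0∞)) =ᵐ[μ]
      fun y => ∑' n, (f '' (u ∩ t n)).indicator 1 y := by
    have : ∀ᵐ y ∂μ, y ∉ f '' (s ∩ Z) := measure_eq_zero_iff_ae_notMem.1 hnull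
    filter_upwards [this] with y hy
    rw [← hcount]
    congr 2
    ext z
    refine ⟨fun h => ⟨⟨h.1, fun hz => hy ⟨z, ⟨h.1, hz⟩, h.2⟩⟩, h.2⟩, fun h => ⟨h.1.1, h.2⟩⟩
  have hind : ∀ n, Measurable ((f '' (u ∩ t n)).indicator (1 : E → ℝ≥0∞)) := fun n =>
    measurable_one.indicator (himg n)
  refine ⟨(Measurable.tsum hind).aemeasurable.congr hae.symm, ?_⟩
  rw [lintegral_congr_ae hae, lintegral_tsum fun n => (hind n).aemeasurable]
  have h1 : ∀ n, ∫⁻ y, (f '' (u ∩ t n)).indicator 1 y ∂μ =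
      ∫⁻ x in u ∩ t n, ENNReal.ofReal |(f' x).det| ∂μ := fun n => by
    rw [lintegral_indicator_one (himg n)]
    exact (lintegral_abs_det_fderiv_eq_addHaar_image μ (hm n)
      (fun x _ => (hf x).hasFDerivWithinAt) (hinj n)).symm
  simp_rw [h1]
  rw [← lintegral_iUnion hm hdisj, ← huU, ← lintegral_inter_add_sdiff _ s hZ,
    setLIntegral_congr_fun (g := 0) (hs.inter hZ) (fun x hx => by simp [show (f' x).det = 0 from hx.2])]
  simp [u]

theorem exists_root_of_odd_natDegree {q : ℝ[X]} (hq : Odd q.natDegree) : ∃ x, q.eval x = 0 := by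
  have hpos : 0 < q.degree := Polynomial.natDegree_pos_iff_degree_pos.1 hq.pos
  have hdeg : (q.comp (-Polynomial.X)).natDegree = q.natDegree := by
    simp [Polynomial.natDegree_comp]
  have hlead : (q.comp (-Polynomial.X)).leadingCoeff = -q.leadingCoeff := by
    rw [Polynomial.leadingCoeff_comp (by simp)]
    simp [hq.neg_one_pow]
  have hpos' : 0 < (q.comp (-Polynomial.X)).degree :=
    Polynomial.natDegree_pos_iff_degree_pos.1 (hdeg ▸ hq.pos)
  have heval : ∀ x, (q.comp (-Polynomial.X)).eval x = q.eval (-x) := by simp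
  rcases le_total 0 q.leadingCoeff with h | h
  · obtain ⟨x, hx⟩ := ((q.tendsto_atTop_of_leadingCoeff_nonneg hpos h).eventually_ge_atTop 0).exists
    obtain ⟨y, hy⟩ := (((q.comp (-Polynomial.X)).tendsto_atBot_of_leadingCoeff_nonpos hpos'
      (by linarith)).eventually_le_atBot 0).exists
    exact mem_range_of_exists_le_of_exists_ge q.continuous ⟨-y, heval y ▸ hy⟩ ⟨x, hx⟩
  · obtain ⟨x, hx⟩ := ((q.tendsto_atBot_of_leadingCoeff_nonpos hpos h).eventually_le_atBot 0).exists
    obtain ⟨y, hy⟩ := (((q.comp (-Polynomial.X)).tendsto_atTop_of_leadingCoeff_nonneg hpos'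
      (by linarith)).eventually_ge_atTop 0).exists
    exact mem_range_of_exists_le_of_exists_ge q.continuous ⟨x, hx⟩ ⟨-y, heval y ▸ hy⟩

theorem even_card_roots_compl {P : ℝ[X]} (hP : P ≠ 0) :
    Even (P.natDegree - P.roots.card) ∧ P.roots.card ≤ P.natDegree := by
  obtain ⟨q, hq, hdeg, hroots⟩ := P.exists_prod_multiset_X_sub_C_mul
  have hq0 : q ≠ 0 := by rintro rfl; exact hP (by simpa using hq.symm)
  have : Even q.natDegree := by
    by_contra h
    obtain ⟨x, hx⟩ := exists_root_of_odd_natDegree (Nat.not_even_iff_odd.1 h)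
    have := (Polynomial.mem_roots hq0).2 hx
    simp [hroots] at this
  exact ⟨by rwa [← hdeg, Nat.add_sub_cancel_left], by omega⟩

/-- A real quartic without multiple real roots has `0`, `2` or `4` real roots. -/
theorem encard_roots_quartic {P : ℝ[X]} (hdeg : P.natDegree = 4)
    (hsimple : ∀ t, P.eval t = 0 → P.derivative.eval t ≠ 0) :
    {t | P.eval t = 0}.encard = 0 ∨ {t | P.eval t = 0}.encard = 2 ∨
      {t | P.eval t = 0}.encard = 4 := by
  have hP : P ≠ 0 := by rintro rfl; simp at hdeg
  have hnodup : P.roots.Nodup := by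
    rw [Multiset.nodup_iff_count_le_one]
    intro t
    rw [Polynomial.count_roots]
    by_contra! h
    obtain ⟨h1, h2⟩ := (Polynomial.one_lt_rootMultiplicity_iff_isRoot hP).1 h
    exact hsimple t h1 h2
  have hset : {t | P.eval t = 0} = (P.roots.toFinset : Set ℝ) := by
    ext t; simp [hP]
  rw [hset, encard_coe_eq_coe_finsetCard, Multiset.toFinset_card_of_nodup hnodup]
  obtain ⟨h1, h2⟩ := even_card_roots_compl hP
  rw [hdeg] at h1 h2
  interval_cases P.roots.card <;> simp_all +decide

theorem exists_angle {x y : ℝ} (h : x ^ 2 + y ^ 2 = 1) :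
    ∃ φ ∈ Ioc (-π) π, cos φ = x ∧ sin φ = y := by
  have hn : ‖(⟨x, y⟩ : ℂ)‖ = 1 := by
    rw [Complex.norm_def, Complex.normSq_mk, ← sq, ← sq, h, sqrt_one]
  refine ⟨Complex.arg ⟨x, y⟩, Complex.arg_mem_Ioc _, ?_, ?_⟩
  · have := Complex.norm_mul_cos_arg ⟨x, y⟩
    rwa [hn, one_mul] at this
  · have := Complex.norm_mul_sin_arg ⟨x, y⟩
    rwa [hn, one_mul] at this

theorem angle_unique {φ ψ : ℝ} (hφ : φ ∈ Ioc (-π) π) (hψ : ψ ∈ Ioc (-π) π)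
    (hc : cos φ = cos ψ) (hs : sin φ = sin ψ) : φ = ψ := by
  have h1 := Complex.arg_cos_add_sin_mul_I hφ
  have h2 := Complex.arg_cos_add_sin_mul_I hψ
  rw [← h1, ← h2]
  simp only [← Complex.ofReal_cos, ← Complex.ofReal_sin, hc, hs]

/-- Support function of the ellipse with semi-axes `a`, `b`. -/
def suppFn (a b φ : ℝ) : ℝ := √((a * cos φ) ^ 2 + (b * sin φ) ^ 2)

/-- The point of the ellipse whose outward unit normal is `(cos φ, sin φ)`: first coordinate. -/
def ellX (a b φ : ℝ) : ℝ := a ^ 2 * cos φ / suppFn a b φ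

/-- The point of the ellipse whose outward unit normal is `(cos φ, sin φ)`: second coordinate. -/
def ellY (a b φ : ℝ) : ℝ := b ^ 2 * sin φ / suppFn a b φ

/-- Radius of curvature of the ellipse at the point with outward unit normal `(cos φ, sin φ)`. -/
def curvRadius (a b φ : ℝ) : ℝ := (a * b) ^ 2 / suppFn a b φ ^ 3

section Ellipse

variable {a b : ℝ}

theorem suppFn_radicand_pos (ha : 0 < a) (hb : 0 < b) (φ : ℝ) :
    0 < (a * cos φ) ^ 2 + (b * sin φ) ^ 2 := by
  by_contra! h
  have h1 : a * cos φ = 0 := by nlinarith [sq_nonneg (a * cos φ), sq_nonneg (b * sin φ)]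
  have h2 : b * sin φ = 0 := by nlinarith [sq_nonneg (a * cos φ), sq_nonneg (b * sin φ)]
  have h3 : cos φ = 0 := by simpa [ha.ne'] using h1
  have h4 : sin φ = 0 := by simpa [hb.ne'] using h2
  simpa [h3, h4] using sin_sq_add_cos_sq φ

theorem suppFn_pos (ha : 0 < a) (hb : 0 < b) (φ : ℝ) : 0 < suppFn a b φ :=
  sqrt_pos.2 (suppFn_radicand_pos ha hb φ)

theorem suppFn_sq (a b φ : ℝ) : suppFn a b φ ^ 2 = (a * cos φ) ^ 2 + (b * sin φ) ^ 2 :=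
  sq_sqrt (by positivity)

theorem suppFn_congr {φ ψ : ℝ} (hc : cos φ = cos ψ) (hs : sin φ = sin ψ) :
    suppFn a b φ = suppFn a b ψ := by simp [suppFn, hc, hs]

theorem curvRadius_pos (ha : 0 < a) (hb : 0 < b) (φ : ℝ) : 0 < curvRadius a b φ := by
  have := suppFn_pos ha hb φ
  unfold curvRadius; positivity

theorem continuous_suppFn : Continuous (suppFn a b) := by unfold suppFn; fun_prop

theorem continuous_ellX (ha : 0 < a) (hb : 0 < b) : Continuous (ellX a b) :=
  (by fun_prop : Continuous fun φ => a ^ 2 * cos φ).div continuous_suppFn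
    fun φ => (suppFn_pos ha hb φ).ne'

theorem continuous_ellY (ha : 0 < a) (hb : 0 < b) : Continuous (ellY a b) :=
  (by fun_prop : Continuous fun φ => b ^ 2 * sin φ).div continuous_suppFn
    fun φ => (suppFn_pos ha hb φ).ne'

theorem continuous_curvRadius (ha : 0 < a) (hb : 0 < b) : Continuous (curvRadius a b) :=
  continuous_const.div (continuous_suppFn.pow 3) fun φ => (pow_pos (suppFn_pos ha hb φ) 3).ne'

theorem hasDerivAt_suppFn (ha : 0 < a) (hb : 0 < b) (φ : ℝ) :
    HasDerivAt (suppFn a b) (-ellX a b φ * sin φ + ellY a b φ * cos φ) φ := by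
  have h1 : HasDerivAt (fun φ => (a * cos φ) ^ 2 + (b * sin φ) ^ 2)
      (2 * (a * cos φ) * (a * -sin φ) + 2 * (b * sin φ) * (b * cos φ)) φ := by
    convert! (((hasDerivAt_cos φ).const_mul a).pow 2).add
      (((hasDerivAt_sin φ).const_mul b).pow 2) using 1
    norm_num
  convert! h1.sqrt (suppFn_radicand_pos ha hb φ).ne' using 1
  have := suppFn_pos ha hb φ
  change _ = _ / (2 * suppFn a b φ)
  unfold ellX ellY
  field_simp

theorem hasDerivAt_ellX (ha : 0 < a) (hb : 0 < b) (φ : ℝ) :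
    HasDerivAt (ellX a b) (-(curvRadius a b φ * sin φ)) φ := by
  have hp := suppFn_pos ha hb φ
  convert! ((hasDerivAt_cos φ).const_mul (a ^ 2)).div (hasDerivAt_suppFn ha hb φ) hp.ne' using 1
  have h2 := suppFn_sq a b φ
  have h3 := sin_sq_add_cos_sq φ
  unfold ellX ellY curvRadius
  field_simp
  rw [h2]
  linear_combination (b ^ 2 * sin φ) * h3

theorem hasDerivAt_ellY (ha : 0 < a) (hb : 0 < b) (φ : ℝ) :
    HasDerivAt (ellY a b) (curvRadius a b φ * cos φ) φ := by
  have hp := suppFn_pos ha hb φ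
  convert! ((hasDerivAt_sin φ).const_mul (b ^ 2)).div (hasDerivAt_suppFn ha hb φ) hp.ne' using 1
  have h2 := suppFn_sq a b φ
  have h3 := sin_sq_add_cos_sq φ
  unfold ellX ellY curvRadius
  field_simp
  rw [h2]
  linear_combination (-a ^ 2 * cos φ) * h3

theorem ell_mem (ha : 0 < a) (hb : 0 < b) (φ : ℝ) :
    ellX a b φ ^ 2 / a ^ 2 + ellY a b φ ^ 2 / b ^ 2 = 1 := by
  have hp := suppFn_pos ha hb φ
  unfold ellX ellY
  field_simp
  rw [suppFn_sq]
  ring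

theorem ell_dot_normal (ha : 0 < a) (hb : 0 < b) (φ : ℝ) :
    ellX a b φ * cos φ + ellY a b φ * sin φ = suppFn a b φ := by
  have hp := suppFn_pos ha hb φ
  unfold ellX ellY
  field_simp
  rw [suppFn_sq]
  ring

theorem exists_ell_eq (ha : 0 < a) (hb : 0 < b) {x y : ℝ} (h : x ^ 2 / a ^ 2 + y ^ 2 / b ^ 2 = 1) :
    ∃ φ ∈ Ioc (-π) π, ellX a b φ = x ∧ ellY a b φ = y := by
  set n := √((x / a ^ 2) ^ 2 + (y / b ^ 2) ^ 2)
  have hpos : 0 < (x / a ^ 2) ^ 2 + (y / b ^ 2) ^ 2 := by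
    by_contra! h0
    have h1 : x / a ^ 2 = 0 := by nlinarith [sq_nonneg (x / a ^ 2), sq_nonneg (y / b ^ 2)]
    have h2 : y / b ^ 2 = 0 := by nlinarith [sq_nonneg (x / a ^ 2), sq_nonneg (y / b ^ 2)]
    have h3 : x = 0 := by simpa [ha.ne'] using h1
    have h4 : y = 0 := by simpa [hb.ne'] using h2
    simp [h3, h4] at h
  have hn : 0 < n := sqrt_pos.2 hpos
  have hn2 : n ^ 2 = (x / a ^ 2) ^ 2 + (y / b ^ 2) ^ 2 := sq_sqrt hpos.le
  obtain ⟨φ, hφ, hc, hs⟩ := exists_angle (x := x / a ^ 2 / n) (y := y / b ^ 2 / n) (by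
    rw [div_pow _ n, div_pow _ n, ← add_div, ← hn2, div_self (by positivity)])
  have hsupp : suppFn a b φ = 1 / n := by
    rw [suppFn, hc, hs, sqrt_eq_iff_eq_sq (by positivity) (by positivity)]
    field_simp
    field_simp at h
    linarith
  refine ⟨φ, hφ, ?_, ?_⟩
  · rw [ellX, hsupp, hc]; field_simp
  · rw [ellY, hsupp, hs]; field_simp

theorem dot_normal_le_suppFn (ha : 0 < a) (hb : 0 < b) {x y : ℝ}
    (h : x ^ 2 / a ^ 2 + y ^ 2 / b ^ 2 ≤ 1) (φ : ℝ) :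
    x * cos φ + y * sin φ ≤ suppFn a b φ := by
  refine le_sqrt_of_sq_le ?_
  have h1 : x * cos φ + y * sin φ = (x / a) * (a * cos φ) + (y / b) * (b * sin φ) := by
    field_simp
  have h2 : (x / a) ^ 2 + (y / b) ^ 2 ≤ 1 := by rwa [div_pow, div_pow]
  rw [h1]
  have h3 : 0 ≤ (a * cos φ) ^ 2 + (b * sin φ) ^ 2 := by positivity
  nlinarith [sq_nonneg ((x / a) * (b * sin φ) - (y / b) * (a * cos φ)),
    mul_le_mul_of_nonneg_right h2 h3]

theorem normal_eq_of_dot_eq (ha : 0 < a) (hb : 0 < b) {φ ψ : ℝ}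
    (h : ellX a b ψ * cos φ + ellY a b ψ * sin φ = suppFn a b φ) :
    cos φ = cos ψ ∧ sin φ = sin ψ := by
  have hφ := suppFn_pos ha hb φ
  have hψ := suppFn_pos ha hb ψ
  have h1 : a ^ 2 * cos ψ * cos φ + b ^ 2 * sin ψ * sin φ = suppFn a b φ * suppFn a b ψ := by
    rw [← h, ellX, ellY]; field_simp
  have h2 : (a * b) ^ 2 * (sin φ * cos ψ - cos φ * sin ψ) ^ 2 = 0 := by
    have h3 := congrArg (· ^ 2) h1
    simp only [mul_pow, suppFn_sq] at h3
    linear_combination -h3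
  have h4 : sin φ * cos ψ - cos φ * sin ψ = 0 := by
    have : (a * b) ^ 2 ≠ 0 := by positivity
    simpa [this] using h2
  have h5 := sin_sq_add_cos_sq φ
  have h6 := sin_sq_add_cos_sq ψ
  set k := cos φ * cos ψ + sin φ * sin ψ
  have hc : cos φ = k * cos ψ := by linear_combination (-cos φ) * h6 + (-sin ψ) * h4
  have hs : sin φ = k * sin ψ := by linear_combination (-sin φ) * h6 + cos ψ * h4
  have hk2 : k ^ 2 = 1 := by
    rw [hc, hs] at h5
    linear_combination h5 - k ^ 2 * h6
  have hk : 0 < k := by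
    have h7 : 0 < k * ((a * cos ψ) ^ 2 + (b * sin ψ) ^ 2) := by
      have h8 := mul_pos hφ hψ
      rw [← h1, hc, hs] at h8
      linarith
    exact (pos_iff_pos_of_mul_pos h7).2 (suppFn_radicand_pos ha hb ψ)
  have hk1 : k = 1 := by nlinarith
  rw [hc, hs, hk1]; simp

theorem mem_of_forall_dot_le (ha : 0 < a) (hb : 0 < b) {x y : ℝ}
    (h : ∀ φ, x * cos φ + y * sin φ ≤ suppFn a b φ) : x ^ 2 / a ^ 2 + y ^ 2 / b ^ 2 ≤ 1 := by
  by_contra! hq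
  set m := x ^ 2 / a ^ 2 + y ^ 2 / b ^ 2
  have hm : 0 < √m := sqrt_pos.2 (by linarith)
  have hm2 : √m ^ 2 = m := sq_sqrt (by linarith)
  obtain ⟨φ, -, hx, hy⟩ := exists_ell_eq ha hb (x := x / √m) (y := y / √m) (by
    rw [div_pow, div_pow, hm2]
    have : 0 < m := by linarith
    have h2 : x ^ 2 / m / a ^ 2 + y ^ 2 / m / b ^ 2 = m / m := by
      simp only [m]; ring
    rw [h2, div_self this.ne'])
  have h1 := ell_dot_normal ha hb φ
  have h2 := h φ
  have h3 : 1 < √m := by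
    rw [lt_sqrt (by norm_num)]; linarith
  rw [hx, hy] at h1
  have h4 : x * cos φ + y * sin φ = √m * suppFn a b φ := by
    rw [← h1]; field_simp
  nlinarith [suppFn_pos ha hb φ]

theorem exists_normal_coordinates (ha : 0 < a) (hb : 0 < b) {x y : ℝ}
    (h : 1 < x ^ 2 / a ^ 2 + y ^ 2 / b ^ 2) :
    ∃ φ ∈ Ioc (-π) π, ∃ ρ > 0,
      x = ellX a b φ + ρ * cos φ ∧ y = ellY a b φ + ρ * sin φ := by
  let m : ℝ → ℝ := fun φ => x * cos φ + y * sin φ - suppFn a b φ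
  have hcont : Continuous m := by
    have := continuous_suppFn (a := a) (b := b)
    fun_prop
  have hper : Function.Periodic m (2 * π) := fun φ => by simp [m, suppFn]
  have hcomp : IsCompact (range m) := hper.compact_of_continuous two_pi_pos.ne' hcont
  obtain ⟨_, ⟨φ, rfl⟩, hmax⟩ := hcomp.exists_isGreatest (range_nonempty m)
  have hmax' : ∀ ψ, m ψ ≤ m φ := fun ψ => hmax (mem_range_self ψ)
  have hpos : 0 < m φ := by
    by_contra! h0
    exact absurd (mem_of_forall_dot_le ha hb fun ψ => by
      have := (hmax' ψ).trans h0
      simp only [m] at this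
      linarith) (not_le.2 h)
  have hder : HasDerivAt m
      (x * -sin φ + y * cos φ - (-ellX a b φ * sin φ + ellY a b φ * cos φ)) φ :=
    (((hasDerivAt_cos φ).const_mul x).add ((hasDerivAt_sin φ).const_mul y)).sub
      (hasDerivAt_suppFn ha hb φ)
  have h0 := IsLocalMax.hasDerivAt_eq_zero (Filter.Eventually.of_forall hmax') hder
  obtain ⟨ψ, hψ, hc, hs⟩ := exists_angle (cos_sq_add_sin_sq φ)
  have hsupp := suppFn_congr (a := a) (b := b) hc hs
  have h1 := ell_dot_normal ha hb φ
  have h2 := sin_sq_add_cos_sq φ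
  have hX : ellX a b ψ = ellX a b φ := by simp [ellX, hc, hsupp]
  have hY : ellY a b ψ = ellY a b φ := by simp [ellY, hs, hsupp]
  refine ⟨ψ, hψ, m φ, hpos, ?_, ?_⟩
  · rw [hX, hc]
    simp only [m]
    rw [← h1]
    linear_combination (-(x - ellX a b φ)) * h2 - sin φ * h0
  · rw [hY, hs]
    simp only [m]
    rw [← h1]
    linear_combination (-(y - ellY a b φ)) * h2 + cos φ * h0

theorem normal_coordinates_unique (ha : 0 < a) (hb : 0 < b) {φ ψ ρ σ : ℝ}
    (hφ : φ ∈ Ioc (-π) π) (hψ : ψ ∈ Ioc (-π) π) (hρ : 0 < ρ) (hσ : 0 < σ)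
    (hx : ellX a b φ + ρ * cos φ = ellX a b ψ + σ * cos ψ)
    (hy : ellY a b φ + ρ * sin φ = ellY a b ψ + σ * sin ψ) : φ = ψ ∧ ρ = σ := by
  have h1 := dot_normal_le_suppFn ha hb (ell_mem ha hb ψ).le φ
  have h2 := dot_normal_le_suppFn ha hb (ell_mem ha hb φ).le ψ
  have h3 := ell_dot_normal ha hb φ
  have h4 := ell_dot_normal ha hb ψ
  have h5 : ρ * (suppFn a b φ - (ellX a b ψ * cos φ + ellY a b ψ * sin φ)) +
      σ * (suppFn a b ψ - (ellX a b φ * cos ψ + ellY a b φ * sin ψ)) ≤ 0 := by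
    have : ρ * (suppFn a b φ - (ellX a b ψ * cos φ + ellY a b ψ * sin φ)) +
      σ * (suppFn a b ψ - (ellX a b φ * cos ψ + ellY a b φ * sin ψ)) =
        -((ellX a b φ - ellX a b ψ) ^ 2 + (ellY a b φ - ellY a b ψ) ^ 2) := by
      rw [← h3, ← h4]
      linear_combination (ellX a b φ - ellX a b ψ) * hx + (ellY a b φ - ellY a b ψ) * hy
    rw [this]
    nlinarith [sq_nonneg (ellX a b φ - ellX a b ψ), sq_nonneg (ellY a b φ - ellY a b ψ)]
  have h6 : ellX a b ψ * cos φ + ellY a b ψ * sin φ = suppFn a b φ := by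
    nlinarith [mul_nonneg hσ.le (sub_nonneg.2 h2), mul_nonneg hρ.le (sub_nonneg.2 h1)]
  obtain ⟨hc, hs⟩ := normal_eq_of_dot_eq ha hb h6
  have hφψ := angle_unique hφ hψ hc hs
  subst hφψ
  refine ⟨rfl, ?_⟩
  have h7 := sin_sq_add_cos_sq φ
  linear_combination cos φ * hx + sin φ * hy + (σ - ρ) * h7

end Ellipse

theorem setLIntegral_ofReal_rectangle {g : ℝ × ℝ → ℝ} (hg : Continuous g) (s t u v : ℝ)
    (hst : s ≤ t) (huv : u ≤ v) (h0 : ∀ p ∈ Ioc s t ×ˢ Ioc u v, 0 ≤ g p) :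
    ∫⁻ p in Ioc s t ×ˢ Ioc u v, ENNReal.ofReal (g p) =
      ENNReal.ofReal (∫ x in s..t, ∫ y in u..v, g (x, y)) := by
  have hint : IntegrableOn g (Ioc s t ×ˢ Ioc u v) :=
    (hg.continuousOn.integrableOn_compact (isCompact_Icc.prod isCompact_Icc)).mono_set
      (prod_mono Ioc_subset_Icc_self Ioc_subset_Icc_self)
  rw [← ofReal_integral_eq_lintegral_ofReal hint
    ((ae_restrict_iff' (measurableSet_Ioc.prod measurableSet_Ioc)).2 (.of_forall h0)),
    Measure.volume_eq_prod, setIntegral_prod _ hint, intervalIntegral.integral_of_le hst]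
  simp_rw [intervalIntegral.integral_of_le huv]

theorem integral_abs_sin_sub (φ : ℝ) : ∫ θ in (-π)..π, |sin (θ - φ)| = 4 := by
  have hper : Function.Periodic (fun θ => |sin θ|) π := fun θ => by simp
  have hcont : Continuous fun θ => |sin θ| := by fun_prop
  have h0 : ∫ θ in (0 : ℝ)..π, |sin θ| = 2 := by
    rw [intervalIntegral.integral_congr (g := sin), integral_sin]
    · norm_num
    · intro θ hθ
      rw [uIcc_of_le pi_pos.le] at hθ
      exact abs_of_nonneg (sin_nonneg_of_mem_Icc hθ)
  have h1 : ∀ c, ∫ θ in c..(c + π), |sin θ| = 2 := fun c => by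
    rw [hper.intervalIntegral_add_eq c 0, zero_add, h0]
  rw [intervalIntegral.integral_comp_sub_right (fun θ => |sin θ|),
    ← intervalIntegral.integral_add_adjacent_intervals
      (hcont.intervalIntegrable _ (-π - φ + π)) (hcont.intervalIntegrable _ _), h1]
  have := h1 (-π - φ + π)
  rw [show -π - φ + π + π = π - φ by ring] at this
  rw [this]
  norm_num

/-- The linear map of the plane with matrix `!![p, q; s, t]`. -/
def planeMap (p q s t : ℝ) : ℝ × ℝ →L[ℝ] ℝ × ℝ :=
  (Matrix.toLin (.finTwoProd ℝ) (.finTwoProd ℝ) !![p, q; s, t]).toContinuousLinearMap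

theorem det_planeMap (p q s t : ℝ) : (planeMap p q s t).det = p * t - q * s := by
  simp only [planeMap, LinearMap.det_toContinuousLinearMap, LinearMap.det_toLin,
    Matrix.det_fin_two_of]

theorem planeMap_eq (p q s t : ℝ) : planeMap p q s t =
    (p • ContinuousLinearMap.fst ℝ ℝ ℝ + q • ContinuousLinearMap.snd ℝ ℝ ℝ).prod
      (s • ContinuousLinearMap.fst ℝ ℝ ℝ + t • ContinuousLinearMap.snd ℝ ℝ ℝ) :=
  Matrix.toLin_finTwoProd_toContinuousLinearMap p q s t

section Maps

variable {a b r : ℝ}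

/-- Center of the circle of radius `r` through the ellipse point with normal angle `x.1`,
where `x.2` is the direction from that point to the center. -/
def centerMap (a b r : ℝ) (x : ℝ × ℝ) : ℝ × ℝ :=
  (ellX a b x.1 + r * cos x.2, ellY a b x.1 + r * sin x.2)

/-- The point at signed distance `x.2` from the ellipse along the outward normal of angle `x.1`. -/
def normalMap (a b : ℝ) (x : ℝ × ℝ) : ℝ × ℝ :=
  (ellX a b x.1 + x.2 * cos x.1, ellY a b x.1 + x.2 * sin x.1)

/-- The derivative of `centerMap`. -/
def centerMapDeriv (a b r : ℝ) (x : ℝ × ℝ) : ℝ × ℝ →L[ℝ] ℝ × ℝ :=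
  planeMap (-(curvRadius a b x.1 * sin x.1)) (-(r * sin x.2))
    (curvRadius a b x.1 * cos x.1) (r * cos x.2)

/-- The derivative of `normalMap`. -/
def normalMapDeriv (a b : ℝ) (x : ℝ × ℝ) : ℝ × ℝ →L[ℝ] ℝ × ℝ :=
  planeMap (-((curvRadius a b x.1 + x.2) * sin x.1)) (cos x.1)
    ((curvRadius a b x.1 + x.2) * cos x.1) (sin x.1)

theorem hasFDerivAt_centerMap (ha : 0 < a) (hb : 0 < b) (x : ℝ × ℝ) :
    HasFDerivAt (centerMap a b r) (centerMapDeriv a b r x) x := by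
  have hfst : HasFDerivAt Prod.fst (ContinuousLinearMap.fst ℝ ℝ ℝ) x := hasFDerivAt_fst
  have hsnd : HasFDerivAt Prod.snd (ContinuousLinearMap.snd ℝ ℝ ℝ) x := hasFDerivAt_snd
  rw [centerMapDeriv, planeMap_eq]
  refine HasFDerivAt.prodMk ?_ ?_
  · convert! ((hasDerivAt_ellX ha hb x.1).comp_hasFDerivAt x hfst).add
      (((hasDerivAt_cos x.2).comp_hasFDerivAt x hsnd).const_mul r) using 1
    ext <;> simp
  · convert! ((hasDerivAt_ellY ha hb x.1).comp_hasFDerivAt x hfst).add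
      (((hasDerivAt_sin x.2).comp_hasFDerivAt x hsnd).const_mul r) using 1
    ext <;> simp

theorem hasFDerivAt_normalMap (ha : 0 < a) (hb : 0 < b) (x : ℝ × ℝ) :
    HasFDerivAt (normalMap a b) (normalMapDeriv a b x) x := by
  have hfst : HasFDerivAt Prod.fst (ContinuousLinearMap.fst ℝ ℝ ℝ) x := hasFDerivAt_fst
  have hsnd : HasFDerivAt Prod.snd (ContinuousLinearMap.snd ℝ ℝ ℝ) x := hasFDerivAt_snd
  rw [normalMapDeriv, planeMap_eq]
  refine HasFDerivAt.prodMk ?_ ?_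
  · convert! ((hasDerivAt_ellX ha hb x.1).comp_hasFDerivAt x hfst).add
      (hsnd.mul ((hasDerivAt_cos x.1).comp_hasFDerivAt x hfst)) using 1
    ext <;> simp
    ring
  · convert! ((hasDerivAt_ellY ha hb x.1).comp_hasFDerivAt x hfst).add
      (hsnd.mul ((hasDerivAt_sin x.1).comp_hasFDerivAt x hfst)) using 1
    ext <;> simp
    ring

theorem det_centerMapDeriv (x : ℝ × ℝ) :
    (centerMapDeriv a b r x).det = r * curvRadius a b x.1 * sin (x.2 - x.1) := by
  rw [centerMapDeriv, det_planeMap, sin_sub]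
  ring

theorem det_normalMapDeriv (x : ℝ × ℝ) :
    (normalMapDeriv a b x).det = -(curvRadius a b x.1 + x.2) := by
  rw [normalMapDeriv, det_planeMap]
  linear_combination (-(curvRadius a b x.1 + x.2)) * sin_sq_add_cos_sq x.1

theorem continuous_det_centerMapDeriv (ha : 0 < a) (hb : 0 < b) :
    Continuous fun x => (centerMapDeriv a b r x).det := by
  simp_rw [det_centerMapDeriv]
  have := continuous_curvRadius ha hb
  fun_prop

theorem lintegral_det_centerMapDeriv (ha : 0 < a) (hb : 0 < b) (hr : 0 < r) :
    ∫⁻ x in Ioc (-π) π ×ˢ Ioc (-π) π, ENNReal.ofReal |(centerMapDeriv a b r x).det| =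
      ENNReal.ofReal (4 * r * ∫ φ in (-π)..π, curvRadius a b φ) := by
  have hpi : -π ≤ π := by linarith [pi_pos]
  rw [setLIntegral_ofReal_rectangle (continuous_det_centerMapDeriv ha hb).abs _ _ _ _ hpi hpi
    fun _ _ => abs_nonneg _]
  congr 1
  rw [← intervalIntegral.integral_const_mul]
  refine intervalIntegral.integral_congr fun φ _ => ?_
  have hR := curvRadius_pos ha hb φ
  simp only [det_centerMapDeriv, abs_mul, abs_of_pos hr, abs_of_pos hR]
  rw [intervalIntegral.integral_const_mul, integral_abs_sin_sub]
  ring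

theorem volume_normalMap_image (ha : 0 < a) (hb : 0 < b) (hr : 0 < r) :
    volume (normalMap a b '' (Ioc (-π) π ×ˢ Ioc 0 r)) =
      ENNReal.ofReal (r * (∫ φ in (-π)..π, curvRadius a b φ) + π * r ^ 2) := by
  have hpi : -π ≤ π := by linarith [pi_pos]
  have hinj : InjOn (normalMap a b) (Ioc (-π) π ×ˢ Ioc 0 r) := by
    rintro ⟨φ, ρ⟩ ⟨hφ, hρ⟩ ⟨ψ, σ⟩ ⟨hψ, hσ⟩ h
    obtain ⟨h1, h2⟩ := Prod.ext_iff.1 h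
    obtain ⟨h3, h4⟩ := normal_coordinates_unique ha hb hφ hψ hρ.1 hσ.1 h1 h2
    exact Prod.ext h3 h4
  have hcont := continuous_curvRadius ha hb
  rw [← lintegral_abs_det_fderiv_eq_addHaar_image volume
    (measurableSet_Ioc.prod measurableSet_Ioc)
    (fun x _ => (hasFDerivAt_normalMap ha hb x).hasFDerivWithinAt) hinj]
  simp_rw [det_normalMapDeriv, abs_neg]
  rw [setLIntegral_ofReal_rectangle (by fun_prop) _ _ _ _ hpi hr.le fun _ _ => abs_nonneg _]
  congr 1
  have h1 : ∀ φ, ∫ ρ in (0 : ℝ)..r, |curvRadius a b φ + ρ| =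
      r * curvRadius a b φ + r ^ 2 / 2 := fun φ => by
    rw [intervalIntegral.integral_congr (g := fun ρ => curvRadius a b φ + ρ)]
    · rw [intervalIntegral.integral_add (by simp) (by simp)]
      simp
    · intro ρ hρ
      rw [uIcc_of_le hr.le] at hρ
      exact abs_of_nonneg (add_nonneg (curvRadius_pos ha hb φ).le hρ.1)
  simp_rw [h1]
  rw [intervalIntegral.integral_add ((by fun_prop : Continuous _).intervalIntegrable _ _)
    (by simp), intervalIntegral.integral_const_mul]
  simp
  ring

/-- The closed elliptical region in `ℝ × ℝ`. -/
def ellRegion (a b : ℝ) : Set (ℝ × ℝ) := {x | x.1 ^ 2 / a ^ 2 + x.2 ^ 2 / b ^ 2 ≤ 1}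

theorem measurableSet_ellRegion : MeasurableSet (ellRegion a b) :=
  measurableSet_le (by fun_prop) (by fun_prop)

theorem volume_ellRegion (ha : 0 < a) (hb : 0 < b) :
    volume (ellRegion a b) = ENNReal.ofReal (π * a * b) := by
  have hdisc : volume (ellRegion 1 1) = ENNReal.ofReal π := by
    have h1 : Complex.measurableEquivRealProd ⁻¹' (ellRegion 1 1) = closedBall 0 1 := by
      ext z
      rw [mem_closedBall, dist_zero_right, ← abs_of_nonneg (norm_nonneg z), ← sq_le_one_iff_abs_le_one,
        ← Complex.normSq_eq_norm_sq, Complex.normSq_apply]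
      simp [ellRegion, sq]
    rw [← Complex.volume_preserving_equiv_real_prod.measure_preimage_equiv, h1,
      Complex.volume_closedBall]
    simp [ENNReal.ofReal, NNReal.pi, Real.toNNReal, pi_pos.le]
    rfl
  have hpre : ellRegion a b = planeMap a⁻¹ 0 0 b⁻¹ ⁻¹' ellRegion 1 1 := by
    ext x
    simp [ellRegion, planeMap_eq, mul_pow, div_eq_inv_mul]
  have hdet : LinearMap.det (planeMap a⁻¹ 0 0 b⁻¹ : ℝ × ℝ →ₗ[ℝ] ℝ × ℝ) = a⁻¹ * b⁻¹ := by
    simpa using det_planeMap a⁻¹ 0 0 b⁻¹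
  have := Measure.addHaar_preimage_linearMap volume (E := ℝ × ℝ)
    (f := (planeMap a⁻¹ 0 0 b⁻¹ : ℝ × ℝ →ₗ[ℝ] ℝ × ℝ)) (by rw [hdet]; positivity) (ellRegion 1 1)
  rw [hpre]
  refine this.trans ?_
  rw [hdet, hdisc, ← ENNReal.ofReal_mul (abs_nonneg _), abs_of_pos (by positivity)]
  congr 1
  field_simp

end Maps

section Counting

variable {a b r : ℝ}

/-- The intersection of the ellipse with the circle of radius `r` about `x`. -/
def meetSet (a b r : ℝ) (x : ℝ × ℝ) : Set (ℝ × ℝ) :=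
  {q | q.1 ^ 2 / a ^ 2 + q.2 ^ 2 / b ^ 2 = 1 ∧ (q.1 - x.1) ^ 2 + (q.2 - x.2) ^ 2 = r ^ 2}

theorem encard_meetSet (ha : 0 < a) (hb : 0 < b) (hr : 0 < r) (x : ℝ × ℝ) :
    (meetSet a b r x).encard =
      ((Ioc (-π) π ×ˢ Ioc (-π) π) ∩ centerMap a b r ⁻¹' {x}).encard := by
  have hinj : InjOn (fun p : ℝ × ℝ => (ellX a b p.1, ellY a b p.1))
      ((Ioc (-π) π ×ˢ Ioc (-π) π) ∩ centerMap a b r ⁻¹' {x}) := by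
    rintro ⟨φ, θ⟩ ⟨⟨hφ, hθ⟩, h⟩ ⟨ψ, η⟩ ⟨⟨hψ, hη⟩, h'⟩ hp
    simp only [Prod.mk.injEq] at hp
    have h1 := (ell_dot_normal ha hb φ)
    rw [hp.1, hp.2] at h1
    obtain ⟨hc, hs⟩ := normal_eq_of_dot_eq ha hb h1
    have hh : centerMap a b r (φ, θ) = centerMap a b r (ψ, η) := h.trans h'.symm
    simp only [centerMap, hp.1, hp.2, Prod.mk.injEq, add_right_inj, mul_eq_mul_left_iff,
      hr.ne', or_false] at hh
    exact Prod.ext (angle_unique hφ hψ hc hs) (angle_unique hθ hη hh.1 hh.2)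
  rw [← hinj.encard_image]
  congr 1
  ext q
  constructor
  · rintro ⟨h1, h2⟩
    obtain ⟨φ, hφ, hX, hY⟩ := exists_ell_eq ha hb h1
    obtain ⟨θ, hθ, hc, hs⟩ := exists_angle (x := (x.1 - q.1) / r) (y := (x.2 - q.2) / r) (by
      field_simp
      linarith)
    refine ⟨(φ, θ), ⟨⟨hφ, hθ⟩, ?_⟩, Prod.ext hX hY⟩
    ext
    · simp only [centerMap, hX, hc]; field_simp; ring
    · simp only [centerMap, hY, hs]; field_simp; ring
  · rintro ⟨⟨φ, θ⟩, ⟨-, rfl⟩, rfl⟩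
    refine ⟨ell_mem ha hb φ, ?_⟩
    simp only [centerMap]
    linear_combination r ^ 2 * sin_sq_add_cos_sq θ

theorem meetSet_nonempty_of_dist_le (ha : 0 < a) (hb : 0 < b) (hr : 0 < r) (hra : r ≤ a)
    {x q : ℝ × ℝ} (hq : q.1 ^ 2 / a ^ 2 + q.2 ^ 2 / b ^ 2 = 1)
    (hd : (q.1 - x.1) ^ 2 + (q.2 - x.2) ^ 2 ≤ r ^ 2) : (meetSet a b r x).Nonempty := by
  have hcont : Continuous fun φ => (ellX a b φ - x.1) ^ 2 + (ellY a b φ - x.2) ^ 2 := by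
    have := continuous_ellX ha hb
    have := continuous_ellY ha hb
    fun_prop
  have hfar : ∃ q : ℝ × ℝ, q.1 ^ 2 / a ^ 2 + q.2 ^ 2 / b ^ 2 = 1 ∧
      r ^ 2 ≤ (q.1 - x.1) ^ 2 + (q.2 - x.2) ^ 2 := by
    rcases le_total 0 x.1 with h | h
    · exact ⟨(-a, 0), by simp [ha.ne'], by simp only; nlinarith [sq_nonneg (0 - x.2)]⟩
    · exact ⟨(a, 0), by simp [ha.ne'], by simp only; nlinarith [sq_nonneg (0 - x.2)]⟩
  obtain ⟨p, hp, hpd⟩ := hfar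
  obtain ⟨φ, -, h1, h2⟩ := exists_ell_eq ha hb hq
  obtain ⟨ψ, -, h3, h4⟩ := exists_ell_eq ha hb hp
  obtain ⟨θ, hθ⟩ := mem_range_of_exists_le_of_exists_ge hcont (c := r ^ 2)
    ⟨φ, by simpa only [h1, h2] using hd⟩ ⟨ψ, by simpa only [h3, h4] using hpd⟩
  exact ⟨(ellX a b θ, ellY a b θ), ell_mem ha hb θ, hθ⟩

theorem exists_ell_dist_le (ha : 0 < a) (hb : 0 < b) (hbr : b ≤ r) {x : ℝ × ℝ}
    (hx : x ∈ ellRegion a b) : ∃ q : ℝ × ℝ, q.1 ^ 2 / a ^ 2 + q.2 ^ 2 / b ^ 2 = 1 ∧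
      (q.1 - x.1) ^ 2 + (q.2 - x.2) ^ 2 ≤ r ^ 2 := by
  have hx' : x.1 ^ 2 / a ^ 2 + x.2 ^ 2 / b ^ 2 ≤ 1 := hx
  have hy0 : 0 ≤ x.2 ^ 2 / b ^ 2 := by positivity
  have hx0 : 0 ≤ x.1 ^ 2 / a ^ 2 := by positivity
  set w := b * √(1 - x.1 ^ 2 / a ^ 2)
  have hw2 : w ^ 2 = b ^ 2 * (1 - x.1 ^ 2 / a ^ 2) := by
    rw [mul_pow, sq_sqrt (by linarith)]
  have hw : 0 ≤ w := by positivity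
  have hwb : w ≤ b := by
    refine (abs_le_of_sq_le_sq' ?_ hb.le).2
    rw [hw2]; nlinarith [mul_nonneg (sq_nonneg b) hx0]
  have hxw : x.2 ^ 2 ≤ w ^ 2 := by
    rw [hw2]
    have := (div_le_iff₀ (by positivity : 0 < b ^ 2)).1 (by linarith : x.2 ^ 2 / b ^ 2 ≤ 1 - x.1 ^ 2 / a ^ 2)
    linarith
  have habs := abs_le_of_sq_le_sq' hxw hw
  have hell : x.1 ^ 2 / a ^ 2 + w ^ 2 / b ^ 2 = 1 := by
    rw [hw2]; field_simp; ring
  rcases le_total 0 x.2 with h | h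
  · exact ⟨(x.1, w), hell, by simp only; nlinarith⟩
  · exact ⟨(x.1, -w), by simpa using hell, by simp only; nlinarith⟩

theorem disjoint_ellRegion_normalMap_image (ha : 0 < a) (hb : 0 < b) :
    Disjoint (ellRegion a b) (normalMap a b '' (Ioc (-π) π ×ˢ Ioc 0 r)) := by
  rw [disjoint_left]
  rintro _ hx ⟨⟨φ, ρ⟩, ⟨-, hρ⟩, rfl⟩
  have h1 := dot_normal_le_suppFn ha hb hx φ
  have h2 := ell_dot_normal ha hb φ
  have h3 := sin_sq_add_cos_sq φ
  simp only [normalMap] at h1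
  have hρ0 : 0 < ρ := hρ.1
  have h4 : (ellX a b φ + ρ * cos φ) * cos φ + (ellY a b φ + ρ * sin φ) * sin φ =
      suppFn a b φ + ρ := by linear_combination h2 + ρ * h3
  linarith

theorem setOf_meetSet_nonempty (ha : 0 < a) (hb : 0 < b) (hbr : b ≤ r) (hra : r ≤ a) :
    {x | (meetSet a b r x).Nonempty} =
      ellRegion a b ∪ normalMap a b '' (Ioc (-π) π ×ˢ Ioc 0 r) := by
  have hr : 0 < r := hb.trans_le hbr
  ext x
  constructor
  · rintro ⟨q, hq, hd⟩
    by_cases hx : x ∈ ellRegion a b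
    · exact Or.inl hx
    obtain ⟨φ, hφ, ρ, hρ, h1, h2⟩ := exists_normal_coordinates ha hb (not_le.1 hx)
    refine Or.inr ⟨(φ, ρ), ⟨hφ, hρ, ?_⟩, Prod.ext h1.symm h2.symm⟩
    have h3 := dot_normal_le_suppFn ha hb hq.le φ
    have h4 := ell_dot_normal ha hb φ
    have h5 := sin_sq_add_cos_sq φ
    have h6 : (x.1 - q.1) * cos φ + (x.2 - q.2) * sin φ =
        ρ + (suppFn a b φ - (q.1 * cos φ + q.2 * sin φ)) := by
      rw [← h4, h1, h2]; linear_combination ρ * h5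
    have h7 : ((x.1 - q.1) * cos φ + (x.2 - q.2) * sin φ) ^ 2 ≤ r ^ 2 := by
      nlinarith [sq_nonneg ((x.1 - q.1) * sin φ - (x.2 - q.2) * cos φ)]
    have h8 := (abs_le_of_sq_le_sq' h7 hr.le).2
    linarith
  · rintro (hx | ⟨⟨φ, ρ⟩, ⟨-, hρ⟩, rfl⟩)
    · obtain ⟨q, hq, hd⟩ := exists_ell_dist_le ha hb hbr hx
      exact meetSet_nonempty_of_dist_le ha hb hr hra hq hd
    · refine meetSet_nonempty_of_dist_le ha hb hr hra (q := (ellX a b φ, ellY a b φ))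
        (ell_mem ha hb φ) ?_
      obtain ⟨h0, h1⟩ : 0 < ρ ∧ ρ ≤ r := hρ
      have h2 : (ellX a b φ - (normalMap a b (φ, ρ)).1) ^ 2 +
          (ellY a b φ - (normalMap a b (φ, ρ)).2) ^ 2 = ρ ^ 2 := by
        simp only [normalMap]
        linear_combination ρ ^ 2 * sin_sq_add_cos_sq φ
      simp only [h2]
      nlinarith

theorem volume_setOf_meetSet_nonempty (ha : 0 < a) (hb : 0 < b) (hbr : b ≤ r) (hra : r ≤ a) :
    volume {x | (meetSet a b r x).Nonempty} = ENNReal.ofReal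
      (π * a * b + (r * (∫ φ in (-π)..π, curvRadius a b φ) + π * r ^ 2)) := by
  have hr : 0 < r := hb.trans_le hbr
  have hL : 0 ≤ ∫ φ in (-π)..π, curvRadius a b φ :=
    intervalIntegral.integral_nonneg (by linarith [pi_pos]) fun φ _ => (curvRadius_pos ha hb φ).le
  rw [setOf_meetSet_nonempty ha hb hbr hra,
    measure_union' (disjoint_ellRegion_normalMap_image ha hb) measurableSet_ellRegion,
    volume_ellRegion ha hb, volume_normalMap_image ha hb hr,
    ← ENNReal.ofReal_add (by positivity) (by positivity)]

open Polynomial in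
/-- The roots of this polynomial are the parameters `t`, in the rational parametrization of the
circle of radius `r` about `x`, of the points of the ellipse. -/
def meetPoly (a b r : ℝ) (x : ℝ × ℝ) : ℝ[X] :=
  C (b ^ 2) * (C (x.1 + r) * X ^ 2 + C (x.1 - r)) ^ 2 +
    C (a ^ 2) * (C x.2 * X ^ 2 - C (2 * r) * X + C x.2) ^ 2 - C (a ^ 2 * b ^ 2) * (X ^ 2 + 1) ^ 2

theorem eval_meetPoly (x : ℝ × ℝ) (t : ℝ) : (meetPoly a b r x).eval t =
    b ^ 2 * ((x.1 + r) * t ^ 2 + (x.1 - r)) ^ 2 + a ^ 2 * (x.2 * t ^ 2 - 2 * r * t + x.2) ^ 2 -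
      a ^ 2 * b ^ 2 * (t ^ 2 + 1) ^ 2 := by
  simp [meetPoly]

theorem eval_derivative_meetPoly (x : ℝ × ℝ) (t : ℝ) : (meetPoly a b r x).derivative.eval t =
    b ^ 2 * (2 * ((x.1 + r) * t ^ 2 + (x.1 - r)) * (2 * (x.1 + r) * t)) +
      a ^ 2 * (2 * (x.2 * t ^ 2 - 2 * r * t + x.2) * (2 * x.2 * t - 2 * r)) -
      a ^ 2 * b ^ 2 * (2 * (t ^ 2 + 1) * (2 * t)) := by
  simp [meetPoly, Polynomial.derivative_pow]
  ring

theorem natDegree_meetPoly {x : ℝ × ℝ}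
    (h : b ^ 2 * (x.1 + r) ^ 2 + a ^ 2 * x.2 ^ 2 - a ^ 2 * b ^ 2 ≠ 0) :
    (meetPoly a b r x).natDegree = 4 := by
  unfold meetPoly
  compute_degree
  · simpa using h
  all_goals norm_num

/-- The rational parametrization of the circle of radius `r` about `x`. -/
def circlePoint (r : ℝ) (x : ℝ × ℝ) (t : ℝ) : ℝ × ℝ :=
  (x.1 - r * ((1 - t ^ 2) / (1 + t ^ 2)), x.2 - r * (2 * t / (1 + t ^ 2)))

theorem circlePoint_mem_ellipse_iff (ha : 0 < a) (hb : 0 < b) (x : ℝ × ℝ) (t : ℝ) :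
    (circlePoint r x t).1 ^ 2 / a ^ 2 + (circlePoint r x t).2 ^ 2 / b ^ 2 = 1 ↔
      (meetPoly a b r x).eval t = 0 := by
  have ht : 0 < 1 + t ^ 2 := by positivity
  rw [eval_meetPoly]
  simp only [circlePoint]
  rw [← sub_eq_zero]
  have : (x.1 - r * ((1 - t ^ 2) / (1 + t ^ 2))) ^ 2 / a ^ 2 +
      (x.2 - r * (2 * t / (1 + t ^ 2))) ^ 2 / b ^ 2 - 1 =
      (b ^ 2 * ((x.1 + r) * t ^ 2 + (x.1 - r)) ^ 2 + a ^ 2 * (x.2 * t ^ 2 - 2 * r * t + x.2) ^ 2 -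
      a ^ 2 * b ^ 2 * (t ^ 2 + 1) ^ 2) / (a ^ 2 * b ^ 2 * (1 + t ^ 2) ^ 2) := by
    field_simp
    ring
  rw [this, div_eq_zero_iff]
  have : a ^ 2 * b ^ 2 * (1 + t ^ 2) ^ 2 ≠ 0 := by positivity
  simp [this]

theorem encard_meetSet_eq_roots (ha : 0 < a) (hb : 0 < b) (hr : 0 < r) {x : ℝ × ℝ}
    (h : b ^ 2 * (x.1 + r) ^ 2 + a ^ 2 * x.2 ^ 2 - a ^ 2 * b ^ 2 ≠ 0) :
    (meetSet a b r x).encard = {t | (meetPoly a b r x).eval t = 0}.encard := by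
  have hinj : Function.Injective (circlePoint r x) := by
    intro s t hst
    have hs : 0 < 1 + s ^ 2 := by positivity
    have ht : 0 < 1 + t ^ 2 := by positivity
    simp only [circlePoint, Prod.mk.injEq, sub_right_inj, mul_eq_mul_left_iff, hr.ne',
      or_false] at hst
    obtain ⟨h1, h2⟩ := hst
    have h3 : s ^ 2 = t ^ 2 := by
      field_simp at h1
      linarith
    rw [h3] at h2
    field_simp at h2
    linarith
  rw [← hinj.encard_image]
  congr 1
  ext q
  constructor
  · rintro ⟨hq, hd⟩
    set c := (x.1 - q.1) / r
    set s := (x.2 - q.2) / r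
    have hc : q.1 = x.1 - r * c := by simp only [c]; field_simp; ring
    have hs : q.2 = x.2 - r * s := by simp only [s]; field_simp; ring
    have hcs : c ^ 2 + s ^ 2 = 1 := by
      simp only [c, s]; field_simp; linarith
    have hc1 : 1 + c ≠ 0 := by
      intro h0
      have hc' : c = -1 := by linarith
      have hs' : s = 0 := by
        rw [hc'] at hcs
        have : s ^ 2 = 0 := by linarith
        simpa using this
      rw [hc, hs, hc', hs'] at hq
      apply h
      field_simp at hq
      linear_combination hq
    have hpos : 1 + (s / (1 + c)) ^ 2 = 2 / (1 + c) := by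
      field_simp
      linear_combination hcs
    have hmem : circlePoint r x (s / (1 + c)) = q := by
      have h1 : (1 - (s / (1 + c)) ^ 2) / (1 + (s / (1 + c)) ^ 2) = c := by
        rw [hpos]
        field_simp
        linear_combination -hcs
      have h2 : 2 * (s / (1 + c)) / (1 + (s / (1 + c)) ^ 2) = s := by
        rw [hpos]
        field_simp
      simp only [circlePoint, h1, h2, ← hc, ← hs]
    refine ⟨s / (1 + c), ?_, hmem⟩
    rw [mem_ofPred_eq, ← circlePoint_mem_ellipse_iff ha hb, hmem]
    exact hq
  · rintro ⟨t, ht, rfl⟩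
    refine ⟨(circlePoint_mem_ellipse_iff ha hb x t).2 ht, ?_⟩
    have ht' : 0 < 1 + t ^ 2 := by positivity
    simp only [circlePoint]
    field_simp
    ring

theorem det_eq_zero_of_double_root (ha : 0 < a) (hb : 0 < b) {x : ℝ × ℝ} (hr : 0 < r) {t : ℝ}
    (h0 : (meetPoly a b r x).eval t = 0) (h1 : (meetPoly a b r x).derivative.eval t = 0) :
    ∃ p, (centerMapDeriv a b r p).det = 0 ∧ centerMap a b r p = x := by
  have ht : 0 < 1 + t ^ 2 := by positivity
  obtain ⟨φ, -, hX, hY⟩ := exists_ell_eq ha hb ((circlePoint_mem_ellipse_iff ha hb x t).2 h0)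
  obtain ⟨θ, -, hc, hs⟩ := exists_angle (x := (1 - t ^ 2) / (1 + t ^ 2))
    (y := 2 * t / (1 + t ^ 2)) (by field_simp; ring)
  refine ⟨(φ, θ), ?_, ?_⟩
  · rw [eval_meetPoly] at h0
    rw [eval_derivative_meetPoly] at h1
    have h2 : 4 * r * (b ^ 2 * ((x.1 + r) * t ^ 2 + (x.1 - r)) * (2 * t) -
        a ^ 2 * (x.2 * t ^ 2 - 2 * r * t + x.2) * (1 - t ^ 2)) = 0 := by
      linear_combination (1 + t ^ 2) * h1 - 4 * t * h0
    have h3 : b ^ 2 * ((x.1 + r) * t ^ 2 + (x.1 - r)) * (2 * t) -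
        a ^ 2 * (x.2 * t ^ 2 - 2 * r * t + x.2) * (1 - t ^ 2) = 0 := by
      simpa [hr.ne'] using h2
    have h4 : b ^ 2 * (circlePoint r x t).1 * sin θ - a ^ 2 * (circlePoint r x t).2 * cos θ = 0 := by
      rw [hs, hc]
      simp only [circlePoint]
      field_simp
      linear_combination h3
    have hp := suppFn_pos ha hb φ
    rw [← hX, ← hY, ellX, ellY] at h4
    have h5 : a ^ 2 * b ^ 2 / suppFn a b φ * (sin θ * cos φ - cos θ * sin φ) = 0 := by
      rw [← h4]; field_simp
    have h6 : a ^ 2 * b ^ 2 / suppFn a b φ ≠ 0 := by positivity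
    rw [det_centerMapDeriv, sin_sub, (mul_eq_zero.1 h5).resolve_left h6, mul_zero]
  · ext
    · simp only [centerMap, hX, hc, circlePoint]; ring
    · simp only [centerMap, hY, hs, circlePoint]; ring

theorem ae_encard_meetSet (ha : 0 < a) (hb : 0 < b) (hr : 0 < r) :
    ∀ᵐ x : ℝ × ℝ, (meetSet a b r x).encard = 0 ∨ (meetSet a b r x).encard = 2 ∨
      (meetSet a b r x).encard = 4 := by
  have hcrit : volume (centerMap a b r '' {p | (centerMapDeriv a b r p).det = 0}) = 0 :=
    addHaar_image_eq_zero_of_det_fderivWithin_eq_zero volume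
      (fun p _ => (hasFDerivAt_centerMap ha hb p).hasFDerivWithinAt) fun p hp => hp
  have hline : volume ((univ : Set ℝ) ×ˢ {π} : Set (ℝ × ℝ)) = 0 := by
    rw [Measure.volume_eq_prod, Measure.prod_prod]; simp
  have hlead : volume (centerMap a b r '' (univ ×ˢ {π})) = 0 :=
    addHaar_image_eq_zero_of_differentiableOn_of_addHaar_eq_zero volume
      (fun p _ => (hasFDerivAt_centerMap ha hb p).differentiableAt.differentiableWithinAt) hline
  filter_upwards [measure_eq_zero_iff_ae_notMem.1 hcrit, measure_eq_zero_iff_ae_notMem.1 hlead]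
    with x h1 h2
  have h3 : b ^ 2 * (x.1 + r) ^ 2 + a ^ 2 * x.2 ^ 2 - a ^ 2 * b ^ 2 ≠ 0 := by
    intro h3
    obtain ⟨φ, -, hX, hY⟩ := exists_ell_eq ha hb (x := x.1 + r) (y := x.2) (by
      field_simp
      linear_combination h3)
    exact h2 ⟨(φ, π), ⟨mem_univ _, rfl⟩, by ext <;> simp [centerMap, hX, hY]⟩
  rw [encard_meetSet_eq_roots ha hb hr h3]
  refine encard_roots_quartic (natDegree_meetPoly h3) fun t h0 h0' => ?_
  obtain ⟨p, hp, hpx⟩ := det_eq_zero_of_double_root ha hb hr h0 h0'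
  exact h1 ⟨p, hp, hpx⟩

theorem volume_ncard_meetSet_eq_two (ha : 0 < a) (hb : 0 < b) (hbr : b ≤ r) (hra : r ≤ a) :
    volume {x | (meetSet a b r x).ncard = 2} =
      ENNReal.ofReal (2 * π * r ^ 2 + 2 * π * a * b) := by
  have hr : 0 < r := hb.trans_le hbr
  obtain ⟨hmeas, hint⟩ := lintegral_encard_fiber volume
    (measurableSet_Ioc.prod measurableSet_Ioc : MeasurableSet (Ioc (-π) π ×ˢ Ioc (-π) π))
    (fun x => hasFDerivAt_centerMap (r := r) ha hb x)
    (continuous_det_centerMapDeriv ha hb).measurable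
  simp_rw [← encard_meetSet ha hb hr] at hmeas hint
  rw [lintegral_det_centerMapDeriv ha hb hr] at hint
  set N : ℝ × ℝ → ENNReal := fun x => ((meetSet a b r x).encard : ENNReal)
  set S : Set (ℝ × ℝ) := {x | (meetSet a b r x).ncard = 2}
  set H : Set (ℝ × ℝ) := {x | (meetSet a b r x).Nonempty}
  have hS : NullMeasurableSet S := by
    have : S = N ⁻¹' {2} := by
      ext x
      simp only [S, N, mem_ofPred_eq, mem_preimage, mem_singleton_iff]
      rw [ncard_def, ENat.toNat_eq_iff two_ne_zero, Nat.cast_ofNat, ← ENat.toENNReal_ofNat,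
        ENat.toENNReal_inj]
    rw [this]
    exact hmeas.nullMeasurableSet_preimage (measurableSet_singleton 2)
  have hH : NullMeasurableSet H := by
    have : H = N ⁻¹' {0}ᶜ := by
      ext x
      simp [H, N, nonempty_iff_ne_empty]
    rw [this]
    exact hmeas.nullMeasurableSet_preimage (measurableSet_singleton 0).compl
  have hae : (fun x => 4 * H.indicator 1 x) =ᵐ[volume] fun x => N x + 2 * S.indicator 1 x := by
    filter_upwards [ae_encard_meetSet ha hb hr] with x hx
    have hHx : x ∈ H ↔ (meetSet a b r x).encard ≠ 0 := by
      simp [H, nonempty_iff_ne_empty]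
    have hSx : x ∈ S ↔ (meetSet a b r x).encard.toNat = 2 := Iff.rfl
    simp only [indicator, hHx, hSx, N]
    rcases hx with h | h | h <;> rw [h] <;> norm_num
  have hkey := lintegral_congr_ae hae
  rw [lintegral_add_left' hmeas, hint, lintegral_const_mul' _ _ (by simp),
    lintegral_const_mul' _ _ (by simp), lintegral_indicator_one₀ hH, lintegral_indicator_one₀ hS,
    volume_setOf_meetSet_nonempty ha hb hbr hra] at hkey
  set L := ∫ φ in (-π)..π, curvRadius a b φ
  have hL : 0 ≤ L :=
    intervalIntegral.integral_nonneg (by linarith [pi_pos]) fun φ _ => (curvRadius_pos ha hb φ).le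
  have hfin : volume S ≠ ⊤ := by
    intro h
    rw [h] at hkey
    simp [ENNReal.mul_eq_top] at hkey
  have hkey' := congrArg ENNReal.toReal hkey
  rw [ENNReal.toReal_add (by simp) (ENNReal.mul_ne_top (by simp) hfin), ENNReal.toReal_mul,
    ENNReal.toReal_mul, ENNReal.toReal_ofReal (by positivity),
    ENNReal.toReal_ofReal (by positivity)] at hkey'
  simp only [ENNReal.toReal_ofNat] at hkey'
  rw [← ENNReal.ofReal_toReal hfin]
  congr 1
  linarith

end Counting

/-- Case 3 of Lemma 1: for `b ≤ r ≤ a`, the area of the set of centers `x` for which the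
circle of radius `r` about `x` meets the ellipse in exactly two points is `2πr² + 2πab`. -/
theorem area_two_intersections_case3 (a b r : ℝ) (hb : 0 < b) (hab : b ≤ a)
    (hr1 : b ≤ r) (hr2 : r ≤ a) :
    volume {x : E2 | (sphere x r ∩ Cset a b).ncard = 2} =
      ENNReal.ofReal (2*π*r^2 + 2*π*a*b) := by
  have ha : 0 < a := hb.trans_le hab
  let e : E2 ≃ᵐ ℝ × ℝ :=
    (MeasurableEquiv.toLp 2 (Fin 2 → ℝ)).symm.trans MeasurableEquiv.finTwoArrow
  have he : MeasurePreserving e volume volume :=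
    (volume_preserving_finTwoArrow ℝ).comp
      (EuclideanSpace.volume_preserving_symm_measurableEquiv_toLp (Fin 2))
  have heq : ∀ x : E2, e x = (x 0, x 1) := fun _ => rfl
  rw [← volume_ncard_meetSet_eq_two ha hb hr1 hr2, ← he.measure_preimage_equiv]
  congr 1
  ext x
  have himg : e '' (sphere x r ∩ Cset a b) = meetSet a b r (e x) := by
    rw [e.image_eq_preimage_symm]
    ext q
    obtain ⟨q, rfl⟩ := e.surjective q
    have hdist : q ∈ sphere x r ↔ (q 0 - x 0) ^ 2 + (q 1 - x 1) ^ 2 = r ^ 2 := by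
      rw [mem_sphere, EuclideanSpace.dist_eq, sqrt_eq_iff_eq_sq (by positivity) (by linarith)]
      simp [Fin.sum_univ_two, Real.dist_eq, sq_abs]
    rw [mem_preimage, e.symm_apply_apply, mem_inter_iff, hdist]
    exact and_comm
  rw [mem_preimage, mem_ofPred_eq, mem_ofPred_eq, ← himg, ncard_image_of_injective _ e.injective]
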